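/- Let R be a finite valuation ring with uniformizer z, nilpotency degree r, and residue field of odd cardinality q. Let G be a subgroup of the unit group R^*, let g, h : G → R^* be arbitrary functions, define f(x,y) = g(x)·(h(x)+y) on G × R^*, and let m = μ(g). Then for all nonempty sets A ⊆ G and B, C ⊆ R^*, one has |f(A,B)| · |B+C| ≥ (1/(8r)) · min{ q^r·|B|/m , |A|·|B|^2·|C| / (m^2·q^{2r-1}) }. -/

import Mathlib

open Pointwise

lemma aux_ker_card {R : Type*} [CommRing R] [Fintype R] (d : R) :
    Nat.card {x : R // d * x = 0} * Nat.card (Ideal.span {d}) = Nat.card R := by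
  have h1 := AddSubgroup.card_mul_index (AddMonoidHom.mulLeft d).ker
  rw [AddSubgroup.index_ker] at h1
  rw [← h1]
  congr 1
  refine Nat.card_congr (Equiv.subtypeEquivRight ?_)
  intro x
  simp only [AddMonoidHom.mem_range, AddMonoidHom.coe_mulLeft, Ideal.mem_span_singleton']
  simp only [mul_comm]

lemma aux_rep {R : Type*} [CommRing R] [IsLocalRing R]
    (z : R) (hz : IsLocalRing.maximalIdeal R = Ideal.span {z})
    (r : ℕ) (hzr : z ^ r = 0) (x : R) : ∃ i ≤ r, ∃ u : Rˣ, x = z ^ i * u := by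
  classical
  have h0 : ∃ i, i ≤ r ∧ z ^ i ∣ x := ⟨0, Nat.zero_le _, by simp⟩
  let i := Nat.findGreatest (fun i => z ^ i ∣ x) r
  have hi : z ^ i ∣ x := Nat.findGreatest_spec (P := fun i => z ^ i ∣ x) (Nat.zero_le r) (by simp)
  have hir : i ≤ r := Nat.findGreatest_le r
  rcases hir.eq_or_lt with h | h
  · refine ⟨r, le_rfl, 1, ?_⟩
    rw [h, hzr] at hi
    simp [zero_dvd_iff.1 hi, hzr]
  · obtain ⟨y, hy⟩ := hi
    by_cases hu : IsUnit y
    · exact ⟨i, hir, hu.unit, by simpa using hy⟩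
    · exfalso
      have : y ∈ IsLocalRing.maximalIdeal R := (IsLocalRing.mem_maximalIdeal y).2 hu
      rw [hz, Ideal.mem_span_singleton] at this
      obtain ⟨w, hw⟩ := this
      have h3 : z ^ (i+1) ∣ x := ⟨w, by rw [hy, hw]; ring⟩
      have := Nat.le_findGreatest (P := fun i => z ^ i ∣ x) (Nat.succ_le_of_lt h) h3
      change i + 1 ≤ i at this
      omega

lemma aux_card_max {R : Type*} [CommRing R] [Fintype R] [IsLocalRing R]
    (z : R) (hz : IsLocalRing.maximalIdeal R = Ideal.span {z})
    (q : ℕ) (hq : Nat.card (IsLocalRing.ResidueField R) = q) :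
    Nat.card (Ideal.span {z}) * q = Nat.card R := by
  rw [← hz, ← hq]
  exact (Submodule.toAddSubgroup (IsLocalRing.maximalIdeal R)).card_mul_index

lemma aux_ann {R : Type*} [CommRing R] [Fintype R] [IsLocalRing R]
    (z : R) (hz : IsLocalRing.maximalIdeal R = Ideal.span {z})
    (q : ℕ) (hq : Nat.card (IsLocalRing.ResidueField R) = q) :
    Nat.card {x : R // z * x = 0} = q := by
  have h1 := aux_ker_card z
  rw [← aux_card_max z hz q hq, mul_comm] at h1
  exact Nat.eq_of_mul_eq_mul_left Nat.card_pos h1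

lemma aux_step {R : Type*} [CommRing R] [Fintype R] [IsLocalRing R]
    (z : R) (hz : IsLocalRing.maximalIdeal R = Ideal.span {z})
    (r : ℕ) (hzr : z ^ r = 0) (hmin : ∀ k < r, z ^ k ≠ 0)
    (q : ℕ) (hq : Nat.card (IsLocalRing.ResidueField R) = q) (j : ℕ) (hj : j < r) :
    Nat.card (Ideal.span {z ^ j}) = q * Nat.card (Ideal.span {z ^ (j+1)}) := by
  let S : AddSubgroup R := Submodule.toAddSubgroup (Ideal.span {z ^ j})
  let φ : S →+ R := (AddMonoidHom.mulLeft z).comp S.subtype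
  have h1 := AddSubgroup.card_mul_index φ.ker
  rw [AddSubgroup.index_ker] at h1
  have h2 : Nat.card φ.ker = q := by
    rw [← aux_ann z hz q hq]
    refine Nat.card_congr ⟨fun x => ⟨x.1.1, x.2⟩, fun x => ⟨⟨x.1, ?_⟩, x.2⟩, fun _ => rfl, fun _ => rfl⟩
    obtain ⟨i, hi, u, hu⟩ := aux_rep z hz r hzr x.1
    have h3 := x.2
    rw [hu, ← mul_assoc, ← pow_succ', Units.mul_left_eq_zero] at h3
    have : ¬ (i + 1 < r) := fun h => hmin _ h h3
    change x.1 ∈ Ideal.span {z ^ j}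
    rw [Ideal.mem_span_singleton, hu]
    exact Dvd.dvd.mul_right (pow_dvd_pow _ (by omega)) _
  have h3 : Nat.card φ.range = Nat.card (Ideal.span {z ^ (j+1)}) := by
    refine Nat.card_congr (Equiv.subtypeEquivRight ?_)
    intro x
    rw [Ideal.mem_span_singleton]
    constructor
    · rintro ⟨⟨y, hy⟩, rfl⟩
      obtain ⟨w, rfl⟩ := Ideal.mem_span_singleton.1 hy
      exact ⟨w, by simp [φ]; ring⟩
    · rintro ⟨w, rfl⟩
      exact ⟨⟨z ^ j * w, Ideal.mem_span_singleton.2 ⟨w, rfl⟩⟩, by simp [φ]; ring⟩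
  rw [h2, h3] at h1
  exact h1.symm

lemma aux_card {R : Type*} [CommRing R] [Fintype R] [IsLocalRing R]
    (z : R) (hz : IsLocalRing.maximalIdeal R = Ideal.span {z})
    (r : ℕ) (hzr : z ^ r = 0) (hmin : ∀ k < r, z ^ k ≠ 0)
    (q : ℕ) (hq : Nat.card (IsLocalRing.ResidueField R) = q) :
    Nat.card R = q ^ r := by
  have h : ∀ j ≤ r, Nat.card R = q ^ j * Nat.card (Ideal.span {z ^ j}) := by
    intro j
    induction j with
    | zero =>
      intro _
      rw [pow_zero, pow_zero, Ideal.span_singleton_one, one_mul]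
      exact (Nat.card_congr (Equiv.Set.univ R)).symm
    | succ j ih =>
      intro hj
      rw [ih (by omega), aux_step z hz r hzr hmin q hq j (by omega), pow_succ q, mul_assoc]
  rw [h r le_rfl, hzr]
  simp

/-- solutions of the linear equation -/
lemma aux_sol {R : Type*} [CommRing R] [Fintype R] [DecidableEq R] (d e : R) :
    (Finset.univ.filter (fun x : R => d * x = e)).card ≤ Nat.card {x : R // d * x = 0} := by
  rw [Nat.card_eq_fintype_card, Fintype.card_subtype]
  rcases (Finset.univ.filter (fun x : R => d * x = e)).eq_empty_or_nonempty with h | ⟨x0, h0⟩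
  · simp [h]
  · refine Finset.card_le_card_of_injOn (fun x => x - x0) ?_ ?_
    · intro x hx
      simp only [Finset.coe_filter, Finset.mem_univ, true_and, Set.mem_ofPred_eq, Finset.mem_filter] at *
      rw [mul_sub, hx, h0, sub_self]
    · intro x _ y _ h
      exact sub_left_injective h

open Classical in
lemma aux_T {R : Type*} [CommRing R] [Fintype R] [IsLocalRing R]
    (z : R) (hz : IsLocalRing.maximalIdeal R = Ideal.span {z})
    (r : ℕ) (hzr : z ^ r = 0) (k l k' l' : R) :
    ((Finset.univ.filter (fun x : R => k * x + l = k' * x + l')).card : ℝ) ≤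
      1 + ∑ j ∈ Finset.Icc 1 r, if (k' - k ∈ Ideal.span {z ^ j} ∧ l' - l ∈ Ideal.span {z ^ j}) then
        (Nat.card R : ℝ) / Nat.card (Ideal.span {z ^ j}) else 0 := by
  have hnn : ∀ j ∈ Finset.Icc 1 r, 0 ≤ if (k' - k ∈ Ideal.span {z ^ j} ∧ l' - l ∈ Ideal.span {z ^ j}) then
        (Nat.card R : ℝ) / Nat.card (Ideal.span {z ^ j}) else 0 := by
    intro j _
    split_ifs <;> positivity
  have hT : (Finset.univ.filter (fun x : R => k * x + l = k' * x + l')) =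
     (Finset.univ.filter (fun x : R => (k' - k) * x = -(l' - l))) := by
    ext x
    simp only [Finset.mem_filter, Finset.mem_univ, true_and]
    constructor <;> intro h <;> linear_combination -h
  rw [hT]
  obtain ⟨i, hi, u, hu⟩ := aux_rep z hz r hzr (k' - k)
  have hspan : Ideal.span {k' - k} = Ideal.span {z ^ i} := by
    rw [hu]
    exact Ideal.span_singleton_mul_right_unit u.isUnit _
  have hk := aux_ker_card (k' - k)
  rw [hspan] at hk
  have hle := aux_sol (k' - k) (-(l' - l))
  rcases Nat.eq_zero_or_pos i with h0 | h0
  · have : Nat.card {x : R // (k' - k) * x = 0} = 1 := by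
      rw [h0, pow_zero, Ideal.span_singleton_one] at hk
      have h2 : Nat.card (⊤ : Ideal R) = Nat.card R := Nat.card_congr (Equiv.Set.univ R)
      rw [h2] at hk
      have : 0 < Nat.card R := Nat.card_pos
      nlinarith
    rw [this] at hle
    have := Finset.sum_nonneg hnn
    have : ((Finset.univ.filter (fun x : R => (k' - k) * x = -(l' - l))).card : ℝ) ≤ 1 := by exact_mod_cast hle
    linarith
  · rcases (Finset.univ.filter (fun x : R => (k' - k) * x = -(l' - l))).eq_empty_or_nonempty with h | ⟨x0, h1⟩
    · rw [h]
      have := Finset.sum_nonneg hnn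
      simp only [Finset.card_empty, Nat.cast_zero]
      linarith
    · have h2 := Finset.single_le_sum hnn (Finset.mem_Icc.2 ⟨h0, hi⟩)
      simp only [Finset.mem_filter, Finset.mem_univ, true_and] at h1
      have hc : (k' - k ∈ Ideal.span {z ^ i} ∧ l' - l ∈ Ideal.span {z ^ i}) := by
        rw [← hspan]
        refine ⟨Ideal.mem_span_singleton_self _, ?_⟩
        rw [Ideal.mem_span_singleton]
        exact ⟨-x0, by linear_combination h1⟩
      rw [if_pos hc] at h2
      have h3 : (Nat.card R : ℝ) / Nat.card (Ideal.span {z ^ i}) = Nat.card {x : R // (k' - k) * x = 0} := by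
        rw [← hk]
        have : (0:ℝ) < Nat.card (Ideal.span {z ^ i}) := by exact_mod_cast Nat.card_pos
        push_cast
        field_simp
      have h4 : ((Finset.univ.filter (fun x : R => (k' - k) * x = -(l' - l))).card : ℝ) ≤ 
        Nat.card {x : R // (k' - k) * x = 0} := by exact_mod_cast hle
      linarith

open Classical in
lemma aux_inc {R : Type*} [CommRing R] [Fintype R] [Nontrivial R] {ι : Type*} (s : Finset ι)
    (k l : ι → R) (P : Finset (R × R)) (V : ℝ)
    (hV : ∑ p ∈ s, ∑ p' ∈ s,
      ((Finset.univ.filter (fun x : R => k p * x + l p = k p' * x + l p')).card : ℝ)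
        ≤ (s.card : ℝ) ^ 2 + V) :
    ((∑ t ∈ P, ∑ p ∈ s, if t.2 = k p * t.1 + l p then (1:ℝ) else 0)
      - (P.card : ℝ) * s.card / Nat.card R) ^ 2 ≤ P.card * V := by
  set I : R × R → ℝ := fun t => ∑ p ∈ s, if t.2 = k p * t.1 + l p then (1:ℝ) else 0 with hI
  set n : ℝ := (Nat.card R : ℝ) with hn
  set L : ℝ := (s.card : ℝ) with hL
  have hnpos : 0 < n := by rw [hn]; exact_mod_cast Nat.card_pos
  have hsumI : ∑ t, I t = L * n := by
    rw [hI]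
    rw [Finset.sum_comm]
    rw [hL, ← nsmul_eq_mul, ← Finset.sum_const]
    refine Finset.sum_congr rfl fun p _ => ?_
    rw [Fintype.sum_prod_type]
    simp [hn]
  have hsumI2 : ∑ t, (I t) ^ 2 = ∑ p ∈ s, ∑ p' ∈ s,
      ((Finset.univ.filter (fun x : R => k p * x + l p = k p' * x + l p')).card : ℝ) := by
    simp only [hI, sq, Finset.sum_mul_sum]
    rw [Finset.sum_comm]
    refine Finset.sum_congr rfl fun p _ => ?_
    rw [Finset.sum_comm]
    refine Finset.sum_congr rfl fun p' _ => ?_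
    rw [Fintype.sum_prod_type]
    rw [Finset.card_filter]
    push_cast
    refine Finset.sum_congr rfl fun x _ => ?_
    simp [eq_comm]
  have hall : ∑ t, (I t - L / n) ^ 2 ≤ V := by
    have : ∑ t, (I t - L / n) ^ 2 = ∑ t, (I t) ^ 2 - 2 * (L / n) * ∑ t, I t
        + ∑ t : R × R, (L / n) ^ 2 := by
      rw [Finset.mul_sum, ← Finset.sum_sub_distrib, ← Finset.sum_add_distrib]
      refine Finset.sum_congr rfl fun x _ => ?_
      ring
    rw [this, hsumI, hsumI2, Finset.sum_const, Finset.card_univ, Fintype.card_prod, nsmul_eq_mul,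
      ← Nat.card_eq_fintype_card]
    push_cast
    rw [← hn]
    have e1 : 2 * (L / n) * (L * n) = 2 * L ^ 2 := by field_simp
    have e2 : n * n * (L / n) ^ 2 = L ^ 2 := by field_simp
    rw [e1, e2]
    linarith
  have e : (∑ t ∈ P, I t) - (P.card : ℝ) * L / n = ∑ t ∈ P, (I t - L / n) := by
    rw [Finset.sum_sub_distrib, Finset.sum_const, nsmul_eq_mul]
    ring
  rw [e]
  refine sq_sum_le_card_mul_sum_sq.trans ?_
  refine mul_le_mul_of_nonneg_left ?_ (Nat.cast_nonneg _)
  refine le_trans ?_ hall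
  exact Finset.sum_le_univ_sum_of_nonneg (fun t => sq_nonneg _)

open Classical in
/-- the total excess over the diagonal expectation -/
lemma aux_V {R : Type*} [CommRing R] [Fintype R] [IsLocalRing R]
    (z : R) (hz : IsLocalRing.maximalIdeal R = Ideal.span {z})
    (r : ℕ) (hzr : z ^ r = 0) (hmin : ∀ k < r, z ^ k ≠ 0)
    (q : ℕ) (hq : Nat.card (IsLocalRing.ResidueField R) = q)
    {ι : Type*} (s : Finset ι) (k l : ι → R) (m : ℕ)
    (hcl : ∀ p ∈ s, ∀ J : Ideal R,
      (s.filter (fun p' => k p' - k p ∈ J ∧ l p' - l p ∈ J)).card ≤ m * (Nat.card J) ^ 2) :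
    ∑ p ∈ s, ∑ p' ∈ s,
      ((Finset.univ.filter (fun x : R => k p * x + l p = k p' * x + l p')).card : ℝ)
        ≤ (s.card : ℝ) ^ 2 + r * m * (q : ℝ) ^ (2 * r - 1) * s.card := by
  have hr : 0 < r := by
    rcases Nat.eq_zero_or_pos r with h | h
    · subst h; simp at hzr
    · exact h
  have hcard := aux_card z hz r hzr hmin q hq
  have hqpos : 0 < q := by
    rcases Nat.eq_zero_or_pos q with h | h
    · rw [h, zero_pow (by omega)] at hcard
      have : 0 < Nat.card R := Nat.card_pos
      omega
    · exact h
  have hmax : Nat.card (Ideal.span {z}) = q ^ (r - 1) := by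
    have h := aux_card_max z hz q hq
    rw [hcard] at h
    have : q ^ r = q ^ (r-1) * q := by rw [← pow_succ]; congr 1; omega
    rw [this] at h
    exact Nat.eq_of_mul_eq_mul_right hqpos h
  have hp : ∀ p ∈ s, ∑ p' ∈ s,
      ((Finset.univ.filter (fun x : R => k p * x + l p = k p' * x + l p')).card : ℝ)
      ≤ s.card + r * m * (q : ℝ) ^ (2 * r - 1) := by
    intro p hps
    refine (Finset.sum_le_sum fun p' _ => aux_T z hz r hzr (k p) (l p) (k p') (l p')).trans ?_
    rw [Finset.sum_add_distrib, Finset.sum_comm]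
    have h1 : ∀ j ∈ Finset.Icc 1 r, (∑ p' ∈ s, if (k p' - k p ∈ Ideal.span {z ^ j} ∧
        l p' - l p ∈ Ideal.span {z ^ j}) then
        (Nat.card R : ℝ) / Nat.card (Ideal.span {z ^ j}) else 0) ≤ m * (q : ℝ) ^ (2 * r - 1) := by
      intro j hj
      rw [← Finset.sum_filter, Finset.sum_const, nsmul_eq_mul]
      have hpos : (0:ℝ) < Nat.card (Ideal.span {z ^ j}) := by exact_mod_cast Nat.card_pos
      have h2 : ((s.filter (fun p' => k p' - k p ∈ Ideal.span {z ^ j} ∧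
        l p' - l p ∈ Ideal.span {z ^ j})).card : ℝ) ≤ m * (Nat.card (Ideal.span {z ^ j}) : ℝ) ^ 2 := by
        exact_mod_cast hcl p hps _
      have h3 : (Nat.card (Ideal.span {z ^ j}) : ℝ) ≤ (q : ℝ) ^ (r - 1) := by
        have : Nat.card (Ideal.span {z ^ j}) ≤ Nat.card (Ideal.span {z}) := by
          refine Nat.card_mono (Set.toFinite _) ?_
          have : Ideal.span {z ^ j} ≤ Ideal.span {z} := by
            rw [Ideal.span_singleton_le_span_singleton]
            exact dvd_pow_self z (by have := (Finset.mem_Icc.1 hj).1; omega)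
          exact this
        rw [hmax] at this
        exact_mod_cast this
      calc _ ≤ m * (Nat.card (Ideal.span {z ^ j}) : ℝ) ^ 2 *
            ((Nat.card R : ℝ) / Nat.card (Ideal.span {z ^ j})) :=
              mul_le_mul_of_nonneg_right h2 (by positivity)
        _ = m * (Nat.card R : ℝ) * Nat.card (Ideal.span {z ^ j}) := by field_simp
        _ ≤ m * (Nat.card R : ℝ) * (q : ℝ) ^ (r - 1) :=
              mul_le_mul_of_nonneg_left h3 (by positivity)
        _ = m * (q : ℝ) ^ (2 * r - 1) := by
              rw [hcard, mul_assoc]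
              push_cast
              rw [← pow_add]
              congr 2
              omega
    have h2 := Finset.sum_le_sum h1
    simp only [Finset.sum_const, nsmul_eq_mul, Nat.card_Icc, mul_one] at h2 ⊢
    simp only [add_tsub_cancel_right] at h2
    linarith
  refine (Finset.sum_le_sum hp).trans ?_
  rw [Finset.sum_const, nsmul_eq_mul]
  apply le_of_eq
  ring

open Classical in
lemma aux_coset {R : Type*} [CommRing R] [Fintype R] (J : Ideal R) {α : Type*} (s : Finset α)
    (φ : α → R) (m : ℕ) (hφ : ∀ y, (s.filter (fun a => φ a = y)).card ≤ m) (w : R) :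
    (s.filter (fun a => φ a - w ∈ J)).card ≤ m * Nat.card J := by
  have h := Finset.card_le_mul_card_image_of_maps_to
    (s := s.filter (fun a => φ a - w ∈ J)) (t := Finset.univ.filter (fun y : R => y - w ∈ J))
    (f := φ) (by intro a ha; simp only [Finset.mem_filter, Finset.mem_univ, true_and] at ha ⊢; exact ha.2)
    m (by
      intro y _
      refine le_trans (Finset.card_le_card ?_) (hφ y)
      intro a ha
      simp only [Finset.mem_filter] at ha ⊢
      exact ⟨ha.1.1, ha.2⟩)
  refine h.trans (Nat.mul_le_mul_left _ ?_)
  have : Nat.card J = (Finset.univ.filter (fun y : R => y ∈ J)).card := by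
    rw [← Fintype.card_subtype, ← Nat.card_eq_fintype_card]
  rw [this]
  refine Finset.card_le_card_of_injOn (fun x => x - w) ?_ ?_
  · intro x hx
    simpa using hx
  · intro x _ y _ h
    exact sub_left_injective h

open Classical in
lemma aux_lines {R : Type*} [CommRing R] [Fintype R] {α : Type*} (A : Finset α) (C : Finset Rˣ)
    (κ : α → R) (η : α → R) (m : ℕ) (hκ : ∀ y, (A.filter (fun a => κ a = y)).card ≤ m)
    (J : Ideal R) (v w : R) :
    ((A ×ˢ C).filter (fun p : α × Rˣ => κ p.1 - v ∈ J ∧ ((p.2 : R) - η p.1) - w ∈ J)).card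
      ≤ m * (Nat.card J) ^ 2 := by
  have h := Finset.card_le_mul_card_image_of_maps_to
    (s := (A ×ˢ C).filter (fun p : α × Rˣ => κ p.1 - v ∈ J ∧ ((p.2 : R) - η p.1) - w ∈ J))
    (t := A.filter (fun a => κ a - v ∈ J)) (f := Prod.fst)
    (by intro a ha
        simp only [Finset.mem_filter, Finset.mem_product] at ha ⊢
        exact ⟨ha.1.1, ha.2.1⟩) (Nat.card J) (by
      intro a _
      have h1 := aux_coset J C (fun c => (c : R)) 1 (by
        intro y
        rw [Finset.card_le_one]
        intro c hc d hd
        simp only [Finset.mem_filter] at hc hd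
        exact Units.ext (hc.2.trans hd.2.symm)) (η a + w)
      rw [one_mul] at h1
      refine le_trans ?_ h1
      refine Finset.card_le_card_of_injOn Prod.snd ?_ ?_
      · rintro ⟨b, c⟩ hp
        simp only [Finset.coe_filter, Finset.mem_filter, Finset.mem_product, Set.mem_ofPred_eq] at hp ⊢
        refine ⟨hp.1.1.2, ?_⟩
        have := hp.1.2.2
        rw [hp.2] at this
        rwa [sub_sub] at this
      · rintro ⟨b, c⟩ hp ⟨b', c'⟩ hp' h
        simp only [Finset.coe_filter, Finset.mem_filter, Finset.mem_product, Set.mem_ofPred_eq] at hp hp' h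
        rw [hp.2, hp'.2, h])
  have h2 := aux_coset J A κ m hκ v
  calc _ ≤ _ := h
    _ ≤ Nat.card J * (m * Nat.card J) := Nat.mul_le_mul_left _ h2
    _ = _ := by ring

lemma aux_real (P Q b L N r m D : ℝ) (hP : 0 ≤ P) (hQ : 0 < Q) (hb : 0 < b) (hL : 0 < L)
    (hr : 1 ≤ r) (hm : 1 ≤ m) (hD : 0 < D) (hN : b * L ≤ N)
    (h : (N - P * L / Q) ^ 2 ≤ P * (r * m * D * L)) :
    P ≥ 1 / (8 * r) * min (Q * b / m) (L * b ^ 2 / (m ^ 2 * D)) := by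
  have hr0 : 0 < r := by linarith
  have hm0 : 0 < m := by linarith
  by_cases hc : P * L / Q ≤ b * L / 2
  · have h1 : b * L / 2 ≤ N - P * L / Q := by linarith
    have h2 : (b * L / 2) ^ 2 ≤ P * (r * m * D * L) :=
      (pow_le_pow_left₀ (by positivity) h1 2).trans h
    have h3 : b ^ 2 * L ≤ 4 * (P * (r * m * D)) := by
      have : (b ^ 2 * L) * L ≤ (4 * (P * (r * m * D))) * L := by nlinarith
      exact le_of_mul_le_mul_right this hL
    calc 1 / (8 * r) * min (Q * b / m) (L * b ^ 2 / (m ^ 2 * D))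
        ≤ 1 / (8 * r) * (L * b ^ 2 / (m ^ 2 * D)) :=
          mul_le_mul_of_nonneg_left (min_le_right _ _) (by positivity)
      _ ≤ P := by
        rw [div_mul_div_comm, div_le_iff₀ (by positivity)]
        have : P * (r * m * D) * 1 ≤ P * (r * m * D) * m :=
          mul_le_mul_of_nonneg_left hm (by positivity)
        have h5 : 0 ≤ P * (r * m * D) * m := by positivity
        nlinarith
  · push Not at hc
    rw [lt_div_iff₀ hQ] at hc
    have h3 : b * Q ≤ 2 * P := by
      have : (b * Q) * L ≤ (2 * P) * L := by nlinarith
      exact le_of_mul_le_mul_right this hL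
    calc 1 / (8 * r) * min (Q * b / m) (L * b ^ 2 / (m ^ 2 * D))
        ≤ 1 / (8 * r) * (Q * b / m) :=
          mul_le_mul_of_nonneg_left (min_le_left _ _) (by positivity)
      _ ≤ P := by
        rw [div_mul_div_comm, div_le_iff₀ (by positivity)]
        have : P * 1 ≤ P * (r * m) := by
          refine mul_le_mul_of_nonneg_left ?_ hP
          nlinarith
        nlinarith

theorem stmt_2 {R : Type*} [CommRing R] [Fintype R] [IsLocalRing R] [IsPrincipalIdealRing R]
    (z : R) (hz : IsLocalRing.maximalIdeal R = Ideal.span {z})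
    (r : ℕ) (hzr : z ^ r = 0) (hmin : ∀ k < r, z ^ k ≠ 0)
    (q : ℕ) (hq : Nat.card (IsLocalRing.ResidueField R) = q) (hqodd : Odd q)
    (G : Subgroup Rˣ) (g h : G → Rˣ)
    (m : ℕ) (hm : m = ⨆ t : Rˣ, Nat.card {x : G // g x = t})
    (A : Set G) (B C : Set Rˣ) (hA : A.Nonempty) (hB : B.Nonempty) (hC : C.Nonempty) :
    (Nat.card (Set.image2 (fun (x : G) (y : Rˣ) => (g x : R) * ((h x : R) + (y : R))) A B) : ℝ)
        * (Nat.card (Set.image2 (fun (b c : Rˣ) => (b : R) + (c : R)) B C) : ℝ) ≥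
      1 / (8 * (r : ℝ)) *
        min ((q : ℝ) ^ r * (Nat.card B : ℝ) / (m : ℝ))
          ((Nat.card A : ℝ) * (Nat.card B : ℝ) ^ 2 * (Nat.card C : ℝ)
            / ((m : ℝ) ^ 2 * (q : ℝ) ^ (2 * r - 1))) := by
  classical
  have hr : 0 < r := by
    rcases Nat.eq_zero_or_pos r with h | h
    · subst h; simp at hzr
    · exact h
  have hqpos : 0 < q := hqodd.pos
  have hle : ∀ t : Rˣ, Nat.card {x : G // g x = t} ≤ m := by
    intro t
    rw [hm]
    exact le_ciSup (f := fun t : Rˣ => Nat.card {x : G // g x = t}) (Set.finite_range _).bddAbove t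
  have hmpos : 1 ≤ m := by
    obtain ⟨a, _⟩ := hA
    refine le_trans ?_ (hle (g a))
    have : Nonempty {x : G // g x = g a} := ⟨⟨a, rfl⟩⟩
    exact Nat.card_pos
  set F := Set.image2 (fun (x : G) (y : Rˣ) => (g x : R) * ((h x : R) + (y : R))) A B with hF
  set S := Set.image2 (fun (b c : Rˣ) => (b : R) + (c : R)) B C with hS
  set κ : G → R := fun a => (((g a)⁻¹ : Rˣ) : R) with hκ
  set η : G → R := fun a => (h a : R) with hη
  have hfib : ∀ y, (A.toFinset.filter (fun a => κ a = y)).card ≤ m := by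
    intro y
    rcases (A.toFinset.filter (fun a => κ a = y)).eq_empty_or_nonempty with h0 | ⟨a, ha⟩
    · simp [h0]
    · refine le_trans ?_ (hle (g a))
      rw [Nat.card_eq_fintype_card, Fintype.card_subtype]
      refine Finset.card_le_card ?_
      intro b hb
      simp only [Finset.mem_filter, Finset.mem_univ, true_and] at ha hb ⊢
      have := Units.ext (hb.2.trans ha.2.symm)
      exact inv_injective this
  set s := A.toFinset ×ˢ C.toFinset with hs
  have hV := aux_V z hz r hzr hmin q hq s (fun p => κ p.1) (fun p => (p.2 : R) - η p.1) m
    (fun p _ J => aux_lines A.toFinset C.toFinset κ η m hfib J (κ p.1) ((p.2 : R) - η p.1))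
  have hinc := aux_inc s (fun p => κ p.1) (fun p => (p.2 : R) - η p.1)
    (F.toFinset ×ˢ S.toFinset) _ (by convert hV using 1)
  rw [aux_card z hz r hzr hmin q hq, Finset.card_product] at hinc
  have hN : (Nat.card B : ℝ) * s.card ≤ ∑ t ∈ F.toFinset ×ˢ S.toFinset, ∑ p ∈ s,
      if t.2 = κ p.1 * t.1 + ((p.2 : R) - η p.1) then (1:ℝ) else 0 := by
    rw [Finset.sum_comm, mul_comm, ← nsmul_eq_mul, ← Finset.sum_const]
    refine Finset.sum_le_sum fun p hp => ?_
    rw [← Finset.sum_filter, Finset.sum_const, nsmul_eq_mul, mul_one]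
    rw [Nat.card_eq_card_toFinset B]
    norm_cast
    simp only [hs, Finset.mem_product, Set.mem_toFinset] at hp
    refine Finset.card_le_card_of_injOn
      (fun b => ((g p.1 : R) * ((h p.1 : R) + (b : R)), (b : R) + (p.2 : R))) ?_ ?_
    · intro b hb
      have hb : b ∈ B := by simpa using hb
      simp only [Finset.coe_filter, Finset.mem_product, Set.mem_toFinset, Set.mem_ofPred_eq]
      refine ⟨⟨Set.mem_image2_of_mem hp.1 hb, Set.mem_image2_of_mem hb hp.2⟩, ?_⟩
      simp only [hκ, hη, ← mul_assoc, Units.inv_mul]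
      ring
    · intro b _ c _ hbc
      have := (Prod.ext_iff.1 hbc).2
      exact Units.ext (add_right_cancel this)
  have hsc : (s.card : ℝ) = (Nat.card A : ℝ) * Nat.card C := by
    rw [hs, Finset.card_product, Nat.card_eq_card_toFinset A, Nat.card_eq_card_toFinset C]
    push_cast; rfl
  have := hA.to_subtype
  have := hB.to_subtype
  have := hC.to_subtype
  have hA0 : (0:ℝ) < Nat.card A := by exact_mod_cast Nat.card_pos
  have hB0 : (0:ℝ) < Nat.card B := by exact_mod_cast Nat.card_pos
  have hC0 : (0:ℝ) < Nat.card C := by exact_mod_cast Nat.card_pos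
  have hfin := aux_real ((Nat.card F : ℝ) * Nat.card S) ((q : ℝ) ^ r) (Nat.card B) s.card
    _ r m ((q : ℝ) ^ (2 * r - 1)) (by positivity) (by positivity) hB0
    (by rw [hsc]; positivity) (by exact_mod_cast hr) (by exact_mod_cast hmpos) (by positivity) hN
    (by
      rw [Nat.card_eq_card_toFinset F, Nat.card_eq_card_toFinset S]
      push_cast at hinc
      convert hinc using 3)
  rw [hsc] at hfin
  convert hfin using 4
  ring
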